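/- The Coxeter–Dickson order Λ is contained in the dual lattice L_Ok* = {v ∈ span_ℝ(Λ) : ⟨v, u⟩ ∈ ℤ for all u ∈ L_Ok}, and the gluing indices satisfy |L_Ok* / L_Ok| = 2²⁴ and |L_Ok* / Λ| = 2¹² = |Λ / L_Ok|; together with the evenness ⟨x,x⟩ ∈ 2ℤ for all x ∈ Λ, the subgroup Λ/L_Ok is a maximal isotropic subgroup of the discriminant group L_Ok*/L_Ok. -/

import Mathlib

noncomputable section

open Quaternion

/-- The octonions as the Cayley–Dickson double of the quaternions. -/
abbrev Octo : Type := ℍ[ℝ] × ℍ[ℝ]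

/-- Octonionic product: `(a,b)·(c,d) = (a c − (conj d) b, d a + b (conj c))`. -/
def omul (x y : Octo) : Octo :=
  (x.1 * y.1 - star y.2 * x.2, y.2 * x.1 + x.2 * star y.1)

/-- Octonionic conjugation: `conj (a,b) = (conj a, −b)`. -/
def oconj (x : Octo) : Octo := (star x.1, -x.2)

def oone : Octo := (1, 0)
def oi : Octo := ((⟨0,1,0,0⟩ : ℍ[ℝ]), 0)
def oj : Octo := ((⟨0,0,1,0⟩ : ℍ[ℝ]), 0)
def ok : Octo := ((⟨0,0,0,1⟩ : ℍ[ℝ]), 0)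
def ol : Octo := (0, 1)

/-- `h = (i + j + k + l)/2`. -/
def oh : Octo := (2⁻¹ : ℝ) • (oi + oj + ok + ol)

/-- The Coxeter–Dickson basis `b₀,…,b₇`. -/
def b : Fin 8 → Octo :=
  ![oone, oi, oj, ok, oh, omul oi oh, omul oj oh, omul ok oh]

/-- The Coxeter–Dickson order: the ℤ-span of `b₀,…,b₇`. -/
def CD : Submodule ℤ Octo := Submodule.span ℤ (Set.range b)

/-- The norm: the sum of the squares of the eight real coordinates. -/
def onorm (x : Octo) : ℝ :=
  x.1.re^2 + x.1.imI^2 + x.1.imJ^2 + x.1.imK^2 +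
  x.2.re^2 + x.2.imI^2 + x.2.imJ^2 + x.2.imK^2

/-- The bilinear form `⟨x,y⟩`, obtained by polarization of the norm,
so that `x·(conj y) + y·(conj x) = ⟨x,y⟩·1`. -/
def binner (x y : Octo) : ℝ := onorm (x + y) - onorm x - onorm y

/-- The scaling exponents `(D₀,…,D₇) = (2,2,2,2,4,4,4,4)`. -/
def Dscale : Fin 8 → ℤ := ![2, 2, 2, 2, 4, 4, 4, 4]

/-- The scaled basis `uᵢ = Dᵢ·bᵢ`. -/
def u : Fin 8 → Octo := fun i => Dscale i • b i

/-- The direct Okubo metric shadow `L_Ok`: the ℤ-span of `u₀,…,u₇`. -/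
def LOk : Submodule ℤ Octo := Submodule.span ℤ (Set.range u)

lemma binner_add_left (x y z : Octo) :
    binner (x + y) z = binner x z + binner y z := by
  simp [binner, onorm, Prod.fst_add, Prod.snd_add]; ring

lemma binner_zsmul_left (c : ℤ) (v w : Octo) :
    binner (c • v) w = (c : ℝ) * binner v w := by
  simp [binner, onorm, Prod.smul_fst, Prod.smul_snd]; ring

/-- The dual lattice `L_Ok* = {v ∈ span_ℝ(Λ) : ⟨v,w⟩ ∈ ℤ for all w ∈ L_Ok}`. -/
def dualLOk : Submodule ℤ Octo where
  carrier := {v | v ∈ Submodule.span ℝ (CD : Set Octo) ∧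
    ∀ w ∈ LOk, ∃ m : ℤ, binner v w = (m : ℝ)}
  zero_mem' := ⟨zero_mem _, fun w _ => ⟨0, by simp [binner, onorm]⟩⟩
  add_mem' := by
    rintro x y ⟨hx1, hx2⟩ ⟨hy1, hy2⟩
    refine ⟨add_mem hx1 hy1, fun w hw => ?_⟩
    obtain ⟨m, hm⟩ := hx2 w hw
    obtain ⟨n, hn⟩ := hy2 w hw
    exact ⟨m + n, by rw [binner_add_left, hm, hn]; push_cast; ring⟩
  smul_mem' := by
    rintro c x ⟨hx1, hx2⟩
    refine ⟨zsmul_mem hx1 c, fun w hw => ?_⟩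
    obtain ⟨m, hm⟩ := hx2 w hw
    exact ⟨c * m, by rw [binner_zsmul_left, hm]; push_cast; ring⟩

/-- The index of the sublattice spanned by integer multiples of a basis. -/
theorem card_quotient_span_zsmul {M ι : Type*} [AddCommGroup M] [Fintype ι]
    {e : ι → M} (he : LinearIndependent ℤ e) (D : ι → ℤ) :
    Nat.card (Submodule.span ℤ (Set.range e) ⧸
      (Submodule.span ℤ (Set.range fun i => D i • e i)).comap
        (Submodule.span ℤ (Set.range e)).subtype) = ∏ i, (D i).natAbs := by
  classical
  let B := Module.Basis.span he
  have hB (i : ι) : (B i : M) = e i := by simp [B, Module.Basis.span_apply]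
  have hmap : ((Submodule.span ℤ (Set.range fun i => D i • e i)).comap
        (Submodule.span ℤ (Set.range e)).subtype).map (B.equivFun : _ →ₗ[ℤ] ι → ℤ) =
      Submodule.pi Set.univ fun i => Ideal.span {D i} := by
    ext c
    rw [Submodule.mem_map_equiv]
    simp only [Submodule.mem_comap, Submodule.subtype_apply, Module.Basis.equivFun_symm_apply,
      Submodule.coe_sum, Submodule.coe_smul, hB, Submodule.mem_span_range_iff_exists_fun,
      Submodule.mem_pi, Set.mem_univ, forall_const, Ideal.mem_span_singleton']
    constructor
    · rintro ⟨a, ha⟩ i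
      refine ⟨a i, ?_⟩
      have h0 : ∑ i, (a i * D i - c i) • e i = 0 := by
        simp only [sub_smul, Finset.sum_sub_distrib, mul_smul, ha, sub_self]
      exact sub_eq_zero.mp (Fintype.linearIndependent_iff.mp he _ h0 i)
    · intro h
      choose a ha using h
      exact ⟨a, by simp only [smul_smul, ha]⟩
  rw [Nat.card_congr (Submodule.Quotient.equiv _ _ B.equivFun hmap).toEquiv,
    Nat.card_congr (Submodule.quotientPi fun i => Ideal.span {D i}).toEquiv, Nat.card_pi]
  exact Finset.prod_congr rfl fun i _ => Nat.card_congr (Int.quotientSpanEquivZMod (D i)).toEquiv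
    |>.trans (Nat.card_zmod _)

/-- Quotient cardinalities multiply along a tower of submodules. -/
theorem card_quotient_mul_card_quotient {R M : Type*} [Ring R] [AddCommGroup M] [Module R M]
    {P Q S : Submodule R M} (hPQ : P ≤ Q) (hQS : Q ≤ S) :
    Nat.card (Q ⧸ P.comap Q.subtype) * Nat.card (S ⧸ Q.comap S.subtype) =
      Nat.card (S ⧸ P.comap S.subtype) :=
  AddSubgroup.relIndex_mul_relIndex P.toAddSubgroup Q.toAddSubgroup S.toAddSubgroup hPQ hQS

theorem binner_eq (x y : Octo) :
    binner x y = 2 * (x.1.re * y.1.re + x.1.imI * y.1.imI + x.1.imJ * y.1.imJ +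
      x.1.imK * y.1.imK + x.2.re * y.2.re + x.2.imI * y.2.imI + x.2.imJ * y.2.imJ +
      x.2.imK * y.2.imK) := by
  simp [binner, onorm]; ring

theorem binner_comm (x y : Octo) : binner x y = binner y x := by
  simp only [binner_eq]; ring

theorem binner_zero_left (y : Octo) : binner 0 y = 0 := by simp [binner_eq]

theorem binner_smul_left (c : ℝ) (x y : Octo) : binner (c • x) y = c * binner x y := by
  simp [binner_eq]; ring

theorem binner_sum_zsmul_left {ι : Type*} [Fintype ι] (c : ι → ℤ) (v : ι → Octo) (w : Octo) :
    binner (∑ i, c i • v i) w = ∑ i, (c i : ℝ) * binner (v i) w := by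
  let f : Octo →+ ℝ :=
    { toFun := fun x => binner x w
      map_zero' := binner_zero_left w
      map_add' := fun x y => binner_add_left x y w }
  have h := map_sum f (fun i => c i • v i) Finset.univ
  simpa only [f, AddMonoidHom.coe_mk, ZeroHom.coe_mk, binner_zsmul_left] using h

theorem binner_self (x : Octo) : binner x x = 2 * onorm x := by
  simp only [binner_eq, onorm]; ring

theorem onorm_add (x y : Octo) : onorm (x + y) = onorm x + onorm y + binner x y := by
  simp [binner]

theorem onorm_zsmul (c : ℤ) (x : Octo) : onorm (c • x) = (c : ℝ) ^ 2 * onorm x := by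
  simp [onorm]; ring

/-- A pairing that is integral on generators is integral on their `ℤ`-span. -/
theorem binner_integral_of_mem_span {ι : Type*} {v : ι → Octo} {w : Octo}
    (h : ∀ i, ∃ m : ℤ, binner (v i) w = m) {x : Octo}
    (hx : x ∈ Submodule.span ℤ (Set.range v)) : ∃ m : ℤ, binner x w = m := by
  induction hx using Submodule.span_induction with
  | mem x hx => obtain ⟨i, rfl⟩ := hx; exact h i
  | zero => exact ⟨0, by simp [binner_zero_left]⟩
  | add x y _ _ hx hy =>
    obtain ⟨m, hm⟩ := hx
    obtain ⟨n, hn⟩ := hy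
    exact ⟨m + n, by rw [binner_add_left, hm, hn]; push_cast; rfl⟩
  | smul c x _ hx =>
    obtain ⟨m, hm⟩ := hx
    exact ⟨c * m, by rw [binner_zsmul_left, hm]; push_cast; rfl⟩

/-- A family having a dual family for `binner` is linearly independent. -/
theorem linearIndependent_of_binner {ι : Type*} [Fintype ι] [DecidableEq ι] {v w : ι → Octo}
    (h : ∀ i j, binner (v i) (w j) = if i = j then 1 else 0) : LinearIndependent ℤ v := by
  rw [Fintype.linearIndependent_iff]
  intro c hc j
  have := binner_sum_zsmul_left c v (w j)
  rw [hc, binner_zero_left] at this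
  simpa [h] using this.symm

theorem oone_coords : oone.1.re = 1 ∧ oone.1.imI = 0 ∧ oone.1.imJ = 0 ∧ oone.1.imK = 0 ∧
    oone.2 = 0 := ⟨rfl, rfl, rfl, rfl, rfl⟩

theorem oi_coords : oi.1.re = 0 ∧ oi.1.imI = 1 ∧ oi.1.imJ = 0 ∧ oi.1.imK = 0 ∧
    oi.2 = 0 := ⟨rfl, rfl, rfl, rfl, rfl⟩

theorem oj_coords : oj.1.re = 0 ∧ oj.1.imI = 0 ∧ oj.1.imJ = 1 ∧ oj.1.imK = 0 ∧
    oj.2 = 0 := ⟨rfl, rfl, rfl, rfl, rfl⟩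

theorem ok_coords : ok.1.re = 0 ∧ ok.1.imI = 0 ∧ ok.1.imJ = 0 ∧ ok.1.imK = 1 ∧
    ok.2 = 0 := ⟨rfl, rfl, rfl, rfl, rfl⟩

theorem ol_coords : ol.1 = 0 ∧ ol.2 = 1 := ⟨rfl, rfl⟩

theorem b_fst_re (i : Fin 8) : (b i).1.re = ![1, 0, 0, 0, 0, -1/2, -1/2, -1/2] i := by
  fin_cases i <;>
    norm_num [b, oh, omul, oone_coords, oi_coords, oj_coords, ok_coords, ol_coords]

theorem b_fst_imI (i : Fin 8) : (b i).1.imI = ![0, 1, 0, 0, 1/2, 0, 1/2, -1/2] i := by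
  fin_cases i <;>
    norm_num [b, oh, omul, oone_coords, oi_coords, oj_coords, ok_coords, ol_coords]

theorem b_fst_imJ (i : Fin 8) : (b i).1.imJ = ![0, 0, 1, 0, 1/2, -1/2, 0, 1/2] i := by
  fin_cases i <;>
    norm_num [b, oh, omul, oone_coords, oi_coords, oj_coords, ok_coords, ol_coords]

theorem b_fst_imK (i : Fin 8) : (b i).1.imK = ![0, 0, 0, 1, 1/2, 1/2, -1/2, 0] i := by
  fin_cases i <;>
    norm_num [b, oh, omul, oone_coords, oi_coords, oj_coords, ok_coords, ol_coords]

theorem b_snd_re (i : Fin 8) : (b i).2.re = ![0, 0, 0, 0, 1/2, 0, 0, 0] i := by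
  fin_cases i <;>
    norm_num [b, oh, omul, oone_coords, oi_coords, oj_coords, ok_coords, ol_coords]

theorem b_snd_imI (i : Fin 8) : (b i).2.imI = ![0, 0, 0, 0, 0, 1/2, 0, 0] i := by
  fin_cases i <;>
    norm_num [b, oh, omul, oone_coords, oi_coords, oj_coords, ok_coords, ol_coords]

theorem b_snd_imJ (i : Fin 8) : (b i).2.imJ = ![0, 0, 0, 0, 0, 0, 1/2, 0] i := by
  fin_cases i <;>
    norm_num [b, oh, omul, oone_coords, oi_coords, oj_coords, ok_coords, ol_coords]

theorem b_snd_imK (i : Fin 8) : (b i).2.imK = ![0, 0, 0, 0, 0, 0, 0, 1/2] i := by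
  fin_cases i <;>
    norm_num [b, oh, omul, oone_coords, oi_coords, oj_coords, ok_coords, ol_coords]

/-- The inverse of the Gram matrix of `b`. -/
def gramInv : Fin 8 → Fin 8 → ℤ :=
  ![![2, 0, 0, 0, 0, 1, 1, 1],
    ![0, 2, 0, 0, -1, 0, -1, 1],
    ![0, 0, 2, 0, -1, 1, 0, -1],
    ![0, 0, 0, 2, -1, -1, 1, 0],
    ![0, -1, -1, -1, 2, 0, 0, 0],
    ![1, 0, 1, -1, 0, 2, 0, 0],
    ![1, -1, 0, 1, 0, 0, 2, 0],
    ![1, 1, -1, 0, 0, 0, 0, 2]]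

/-- The basis of `ℝ⁸` dual to `b` under `binner`. -/
def dualB (i : Fin 8) : Octo := ∑ j, (gramInv i j : ℝ) • b j

theorem dualB_fst_re (i : Fin 8) : (dualB i).1.re = ![1/2, 0, 0, 0, 0, 0, 0, 0] i := by
  simp only [dualB, Fin.sum_univ_eight, Prod.fst_add, Prod.smul_fst, Quaternion.re_add,
    Quaternion.re_smul, b_fst_re, smul_eq_mul]
  fin_cases i <;> simp [gramInv] <;> norm_num

theorem dualB_fst_imI (i : Fin 8) : (dualB i).1.imI = ![0, 1/2, 0, 0, 0, 0, 0, 0] i := by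
  simp only [dualB, Fin.sum_univ_eight, Prod.fst_add, Prod.smul_fst, Quaternion.imI_add,
    Quaternion.imI_smul, b_fst_imI, smul_eq_mul]
  fin_cases i <;> simp [gramInv] <;> norm_num

theorem dualB_fst_imJ (i : Fin 8) : (dualB i).1.imJ = ![0, 0, 1/2, 0, 0, 0, 0, 0] i := by
  simp only [dualB, Fin.sum_univ_eight, Prod.fst_add, Prod.smul_fst, Quaternion.imJ_add,
    Quaternion.imJ_smul, b_fst_imJ, smul_eq_mul]
  fin_cases i <;> simp [gramInv] <;> norm_num

theorem dualB_fst_imK (i : Fin 8) : (dualB i).1.imK = ![0, 0, 0, 1/2, 0, 0, 0, 0] i := by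
  simp only [dualB, Fin.sum_univ_eight, Prod.fst_add, Prod.smul_fst, Quaternion.imK_add,
    Quaternion.imK_smul, b_fst_imK, smul_eq_mul]
  fin_cases i <;> simp [gramInv] <;> norm_num

theorem dualB_snd_re (i : Fin 8) : (dualB i).2.re = ![0, -1/2, -1/2, -1/2, 1, 0, 0, 0] i := by
  simp only [dualB, Fin.sum_univ_eight, Prod.snd_add, Prod.smul_snd, Quaternion.re_add,
    Quaternion.re_smul, b_snd_re, smul_eq_mul]
  fin_cases i <;> simp [gramInv] <;> norm_num

theorem dualB_snd_imI (i : Fin 8) : (dualB i).2.imI = ![1/2, 0, 1/2, -1/2, 0, 1, 0, 0] i := by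
  simp only [dualB, Fin.sum_univ_eight, Prod.snd_add, Prod.smul_snd, Quaternion.imI_add,
    Quaternion.imI_smul, b_snd_imI, smul_eq_mul]
  fin_cases i <;> simp [gramInv] <;> norm_num

theorem dualB_snd_imJ (i : Fin 8) : (dualB i).2.imJ = ![1/2, -1/2, 0, 1/2, 0, 0, 1, 0] i := by
  simp only [dualB, Fin.sum_univ_eight, Prod.snd_add, Prod.smul_snd, Quaternion.imJ_add,
    Quaternion.imJ_smul, b_snd_imJ, smul_eq_mul]
  fin_cases i <;> simp [gramInv] <;> norm_num

theorem dualB_snd_imK (i : Fin 8) : (dualB i).2.imK = ![1/2, 1/2, -1/2, 0, 0, 0, 0, 1] i := by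
  simp only [dualB, Fin.sum_univ_eight, Prod.snd_add, Prod.smul_snd, Quaternion.imK_add,
    Quaternion.imK_smul, b_snd_imK, smul_eq_mul]
  fin_cases i <;> simp [gramInv] <;> norm_num

theorem binner_b_dualB (i j : Fin 8) : binner (b i) (dualB j) = if i = j then 1 else 0 := by
  rw [binner_eq]
  simp only [b_fst_re, b_fst_imI, b_fst_imJ, b_fst_imK, b_snd_re, b_snd_imI, b_snd_imJ, b_snd_imK,
    dualB_fst_re, dualB_fst_imI, dualB_fst_imJ, dualB_fst_imK, dualB_snd_re, dualB_snd_imI,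
    dualB_snd_imJ, dualB_snd_imK]
  fin_cases i <;> fin_cases j <;> norm_num

theorem sum_binner_smul_dualB (v : Octo) : ∑ i, binner v (b i) • dualB i = v := by
  ext <;>
  · simp [Fin.sum_univ_eight, binner_eq, b_fst_re, b_fst_imI, b_fst_imJ, b_fst_imK, b_snd_re,
      b_snd_imI, b_snd_imJ, b_snd_imK, dualB_fst_re, dualB_fst_imI, dualB_fst_imJ, dualB_fst_imK,
      dualB_snd_re, dualB_snd_imI, dualB_snd_imJ, dualB_snd_imK]
    try ring

theorem binner_b_b_integral (i j : Fin 8) : ∃ m : ℤ, binner (b i) (b j) = m := by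
  rw [binner_eq]
  simp only [b_fst_re, b_fst_imI, b_fst_imJ, b_fst_imK, b_snd_re, b_snd_imI, b_snd_imJ, b_snd_imK]
  fin_cases i <;> fin_cases j <;>
    first
    | (refine ⟨0, ?_⟩; norm_num; done)
    | (refine ⟨1, ?_⟩; norm_num; done)
    | (refine ⟨-1, ?_⟩; norm_num; done)
    | (refine ⟨2, ?_⟩; norm_num; done)

theorem onorm_b (i : Fin 8) : onorm (b i) = 1 := by
  simp only [onorm, b_fst_re, b_fst_imI, b_fst_imJ, b_fst_imK, b_snd_re, b_snd_imI, b_snd_imJ,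
    b_snd_imK]
  fin_cases i <;> norm_num

theorem dualB_mem_CD (i : Fin 8) : dualB i ∈ CD :=
  sum_mem fun j _ => by
    rw [Int.cast_smul_eq_zsmul]
    exact zsmul_mem (Submodule.subset_span (Set.mem_range_self j)) _

theorem binner_integral_of_mem_CD {x y : Octo} (hx : x ∈ CD) (hy : y ∈ CD) :
    ∃ m : ℤ, binner x y = m := by
  refine binner_integral_of_mem_span (fun i => ?_) hx
  rw [binner_comm]
  refine binner_integral_of_mem_span (fun j => ?_) hy
  exact binner_b_b_integral j i

theorem onorm_integral_of_mem_CD {x : Octo} (hx : x ∈ CD) : ∃ m : ℤ, onorm x = m := by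
  unfold CD at hx
  induction hx using Submodule.span_induction with
  | mem x hx => obtain ⟨i, rfl⟩ := hx; exact ⟨1, by simp [onorm_b]⟩
  | zero => exact ⟨0, by simp [onorm]⟩
  | add x y hx hy ihx ihy =>
    obtain ⟨m, hm⟩ := ihx
    obtain ⟨n, hn⟩ := ihy
    obtain ⟨k, hk⟩ := binner_integral_of_mem_CD hx hy
    exact ⟨m + n + k, by rw [onorm_add, hm, hn, hk]; push_cast; rfl⟩
  | smul c x _ ihx =>
    obtain ⟨m, hm⟩ := ihx
    exact ⟨c ^ 2 * m, by rw [onorm_zsmul, hm]; push_cast; rfl⟩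

theorem CD_eq_span_dualB : CD = Submodule.span ℤ (Set.range dualB) := by
  apply le_antisymm <;> refine Submodule.span_le.mpr ?_ <;> rintro _ ⟨i, rfl⟩
  · rw [SetLike.mem_coe, ← sum_binner_smul_dualB (b i)]
    refine sum_mem fun j _ => ?_
    obtain ⟨m, hm⟩ := binner_b_b_integral i j
    rw [hm, Int.cast_smul_eq_zsmul]
    exact zsmul_mem (Submodule.subset_span (Set.mem_range_self j)) m
  · exact dualB_mem_CD i

theorem Dscale_cast_ne_zero (i : Fin 8) : (Dscale i : ℝ) ≠ 0 := by
  fin_cases i <;> norm_num [Dscale]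

/-- The basis dual to `u` under `binner`. -/
def dualU (i : Fin 8) : Octo := (Dscale i : ℝ)⁻¹ • dualB i

theorem Dscale_zsmul_dualU (i : Fin 8) : Dscale i • dualU i = dualB i := by
  rw [dualU, ← Int.cast_smul_eq_zsmul ℝ, smul_inv_smul₀ (Dscale_cast_ne_zero i)]

theorem binner_u_dualU (i j : Fin 8) : binner (u i) (dualU j) = if i = j then 1 else 0 := by
  rw [u, binner_zsmul_left, binner_comm, dualU, binner_smul_left, binner_comm, binner_b_dualB]
  split_ifs with h
  · subst h; simpa using mul_inv_cancel₀ (Dscale_cast_ne_zero i)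
  · simp

theorem mem_span_real_CD (v : Octo) : v ∈ Submodule.span ℝ (CD : Set Octo) := by
  rw [← sum_binner_smul_dualB v]
  exact sum_mem fun i _ => Submodule.smul_mem _ _ (Submodule.subset_span (dualB_mem_CD i))

theorem dualLOk_eq_span_dualU : dualLOk = Submodule.span ℤ (Set.range dualU) := by
  apply le_antisymm
  · rintro v ⟨-, hv⟩
    rw [← sum_binner_smul_dualB v]
    refine sum_mem fun i _ => ?_
    obtain ⟨m, hm⟩ := hv (u i) (Submodule.subset_span (Set.mem_range_self i))
    rw [u, binner_comm, binner_zsmul_left, binner_comm] at hm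
    rw [← Dscale_zsmul_dualU, ← Int.cast_smul_eq_zsmul ℝ, smul_smul, mul_comm, hm,
      Int.cast_smul_eq_zsmul]
    exact zsmul_mem (Submodule.subset_span (Set.mem_range_self i)) m
  · refine Submodule.span_le.mpr ?_
    rintro _ ⟨i, rfl⟩
    refine ⟨mem_span_real_CD _, fun w hw => ?_⟩
    rw [binner_comm]
    refine binner_integral_of_mem_span (fun j => ?_) hw
    exact ⟨if j = i then 1 else 0, by rw [binner_u_dualU]; push_cast; rfl⟩

theorem LOk_le_CD : LOk ≤ CD := by
  refine Submodule.span_le.mpr ?_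
  rintro _ ⟨i, rfl⟩
  exact zsmul_mem (Submodule.subset_span (Set.mem_range_self i)) _

theorem CD_le_dualLOk : CD ≤ dualLOk := fun v hv =>
  ⟨mem_span_real_CD v, fun _ hw => binner_integral_of_mem_CD hv (LOk_le_CD hw)⟩

theorem prod_natAbs_Dscale : ∏ i, (Dscale i).natAbs = 2 ^ 12 := by decide

theorem card_CD_quotient_LOk : Nat.card (CD ⧸ LOk.comap CD.subtype) = 2 ^ 12 :=
  (card_quotient_span_zsmul (linearIndependent_of_binner binner_b_dualB) Dscale).trans
    prod_natAbs_Dscale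

theorem card_dualLOk_quotient_CD :
    Nat.card (dualLOk ⧸ CD.comap dualLOk.subtype) = 2 ^ 12 := by
  have h := card_quotient_span_zsmul (linearIndependent_of_binner (v := dualU) (w := u)
    fun i j => by rw [binner_comm, binner_u_dualU]; simp only [eq_comm]) Dscale
  simp only [Dscale_zsmul_dualU] at h
  change Nat.card (_ ⧸ Submodule.comap _ (Submodule.span ℤ (Set.range dualB))) = _ at h
  rw [← CD_eq_span_dualB, ← dualLOk_eq_span_dualU] at h
  rw [h, prod_natAbs_Dscale]

/-- `Λ ⊆ L_Ok*`, the gluing indices `|L_Ok*/L_Ok| = 2²⁴`,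
`|L_Ok*/Λ| = 2¹² = |Λ/L_Ok|`, and together with the evenness of `Λ` this makes
`Λ/L_Ok` a maximal isotropic subgroup of the discriminant group `L_Ok*/L_Ok`
(maximality being the equality `|Λ/L_Ok|² = |L_Ok*/L_Ok|`). -/
theorem okubo_shadow_gluing :
    CD ≤ dualLOk ∧ LOk ≤ CD ∧
    Nat.card (dualLOk ⧸ LOk.comap dualLOk.subtype) = 2 ^ 24 ∧
    Nat.card (dualLOk ⧸ CD.comap dualLOk.subtype) = 2 ^ 12 ∧
    Nat.card (CD ⧸ LOk.comap CD.subtype) = 2 ^ 12 ∧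
    (∀ x ∈ CD, ∃ m : ℤ, binner x x = 2 * (m : ℝ)) ∧
    Nat.card (CD ⧸ LOk.comap CD.subtype) ^ 2
      = Nat.card (dualLOk ⧸ LOk.comap dualLOk.subtype) := by
  have htower := card_quotient_mul_card_quotient LOk_le_CD CD_le_dualLOk
  rw [card_CD_quotient_LOk, card_dualLOk_quotient_CD] at htower
  refine ⟨CD_le_dualLOk, LOk_le_CD, by rw [← htower]; norm_num, card_dualLOk_quotient_CD,
    card_CD_quotient_LOk, fun x hx => ?_, by rw [← htower, card_CD_quotient_LOk]; norm_num⟩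
  obtain ⟨m, hm⟩ := onorm_integral_of_mem_CD hx
  exact ⟨m, by rw [binner_self, hm]⟩

end
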